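/- arXiv:2509.21154 — 3 statements merged into one kernel-verified Lean document; each statement's English description precedes it below -/
import Mathlib

section
/- (Theorem 1, generalized form.) For arbitrary prefix-dependent token weights, replacing outcome-level advantages by step-level advantages does not change the GRPO loss: ∑_{i=1}^k ∑_{t=0}^{len(g_i)−1} (P_{i,t}·a_i − D_{i,t}) = ∑_{i=1}^k ∑_{t=0}^{len(g_i)−1} (P_{i,t}·A_{i,t} − D_{i,t}). -/
/-- `nodeG g p` is the set of indices `i` such that `p` is a prefix of the trajectory `g i`. -/
noncomputable def nodeG {α : Type*} {k : ℕ} (g : Fin k → List α) (p : List α) :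
    Finset (Fin k) :=
  @Finset.filter _ (fun i => p <+: g i) (Classical.decPred _) Finset.univ

/-- `BG g` is the family of process sets: nonempty sets of the form `nodeG g p`. -/
def BG {α : Type*} {k : ℕ} (g : Fin k → List α) : Set (Finset (Fin k)) :=
  {L | ∃ p : List α, (nodeG g p).Nonempty ∧ nodeG g p = L}

/-- `eG g L` is the length of the longest common prefix of the trajectories `g i`, `i ∈ L`. -/
noncomputable def eG {α : Type*} {k : ℕ} (g : Fin k → List α) (L : Finset (Fin k)) : ℕ :=
  sSup {n : ℕ | ∃ p : List α, p.length = n ∧ ∀ i ∈ L, p <+: g i}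

-- The immediate parent of a process set: its least strict superset in `BG g`.
open Classical in
noncomputable def parentG {α : Type*} {k : ℕ} (g : Fin k → List α) (L : Finset (Fin k)) :
    Finset (Fin k) :=
  if h : ∃ M, M ∈ BG g ∧ L ⊂ M ∧ ∀ M' ∈ BG g, L ⊂ M' → M ⊆ M' then h.choose
  else Finset.univ

/-- Start index of the process step of `L`: `0` for the root, `eG g (parentG g L)` otherwise. -/
noncomputable def sG {α : Type*} {k : ℕ} (g : Fin k → List α) (L : Finset (Fin k)) : ℕ :=
  if L = Finset.univ then 0 else eG g (parentG g L)

/-- `XtG g t` is the family of process sets whose token span contains the index `t`. -/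
noncomputable def XtG {α : Type*} {k : ℕ} (g : Fin k → List α) (t : ℕ) :
    Finset (Finset (Fin k)) :=
  @Finset.filter _ (fun L => L ∈ BG g ∧ sG g L ≤ t ∧ t < eG g L)
    (Classical.decPred _) Finset.univ

/-- Mean of the rewards. -/
noncomputable def rmeanG {k : ℕ} (r : Fin k → ℝ) : ℝ := (∑ i, r i) / k

/-- Standard deviation of the rewards. -/
noncomputable def rstdG {k : ℕ} (r : Fin k → ℝ) : ℝ :=
  Real.sqrt ((∑ i, (r i - rmeanG r) ^ 2) / k)

/-- Outcome-level advantage `a_i`. -/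
noncomputable def advG {k : ℕ} (r : Fin k → ℝ) (i : Fin k) : ℝ :=
  (r i - rmeanG r) / rstdG r

/-- Step-level reward `R̂(λ)`. -/
noncomputable def RhatG {k : ℕ} (r : Fin k → ℝ) (L : Finset (Fin k)) : ℝ :=
  (∑ i ∈ L, r i) / L.card

/-- Step-level advantage `Â(λ)`. -/
noncomputable def AhatG {k : ℕ} (r : Fin k → ℝ) (L : Finset (Fin k)) : ℝ :=
  (RhatG r L - rmeanG r) / rstdG r

theorem mem_nodeG {α : Type*} {k : ℕ} {g : Fin k → List α} {p : List α} {i : Fin k} :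
    i ∈ nodeG g p ↔ p <+: g i := by
  simp [nodeG]

/-- Over a nonempty set of indices, the outcome-level advantages sum to the step-level advantage
times the number of indices. -/
theorem sum_advG_eq_card_mul_AhatG {k : ℕ} (r : Fin k → ℝ) {L : Finset (Fin k)}
    (hL : L.Nonempty) : ∑ i ∈ L, advG r i = L.card * AhatG r L := by
  have hcard : (L.card : ℝ) ≠ 0 := by exact_mod_cast hL.card_pos.ne'
  simp only [advG, AhatG, RhatG]
  rw [← Finset.sum_div, Finset.sum_sub_distrib, Finset.sum_const, nsmul_eq_mul,
    mul_div_assoc', mul_sub, mul_div_cancel₀ _ hcard]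

/-- The trajectories longer than `t` with prefix `p` of length `t + 1` form the node of `p`. -/
theorem filter_take_eq_nodeG {α : Type*} [DecidableEq α] {k : ℕ} (g : Fin k → List α) {t : ℕ}
    {p : List α} (hp : p.length = t + 1) :
    ({i | t < (g i).length ∧ (g i).take (t + 1) = p} : Finset (Fin k)) = nodeG g p := by
  ext i
  rw [mem_nodeG, List.prefix_iff_eq_take, hp, Finset.mem_filter_univ]
  refine ⟨fun h => h.2.symm, fun h => ⟨?_, h.symm⟩⟩
  have := congrArg List.length h
  rw [hp, List.length_take] at this
  omega

/-- At a fixed token position, weighting by a function of the prefix does not distinguish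
outcome-level from step-level advantages. -/
theorem sum_mul_advG_eq_sum_mul_AhatG {α : Type*} {k : ℕ} (g : Fin k → List α) (r : Fin k → ℝ)
    (F : List α → ℝ) (t : ℕ) :
    ∑ i with t < (g i).length, F ((g i).take (t + 1)) * advG r i =
      ∑ i with t < (g i).length,
        F ((g i).take (t + 1)) * AhatG r (nodeG g ((g i).take (t + 1))) := by
  classical
  have hmaps : ∀ i ∈ ({i | t < (g i).length} : Finset (Fin k)), (g i).take (t + 1) ∈
      ({i | t < (g i).length} : Finset (Fin k)).image fun i => (g i).take (t + 1) :=
    fun i hi => Finset.mem_image_of_mem _ hi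
  rw [← Finset.sum_fiberwise_of_maps_to hmaps, ← Finset.sum_fiberwise_of_maps_to hmaps]
  refine Finset.sum_congr rfl fun p hp => ?_
  obtain ⟨j, hj, rfl⟩ := Finset.mem_image.1 hp
  rw [Finset.mem_filter_univ] at hj
  have hlen : ((g j).take (t + 1)).length = t + 1 := by
    rw [List.length_take]
    omega
  generalize hq : (g j).take (t + 1) = q at hlen
  have hne : (nodeG g q).Nonempty := ⟨j, mem_nodeG.2 (hq ▸ List.take_prefix _ _)⟩
  rw [Finset.filter_filter, filter_take_eq_nodeG g hlen]
  have htake : ∀ i ∈ nodeG g q, (g i).take (t + 1) = q := fun i hi => by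
    rw [← hlen, ← List.prefix_iff_eq_take.1 (mem_nodeG.1 hi)]
  calc
    _ = ∑ i ∈ nodeG g q, F q * advG r i :=
      Finset.sum_congr rfl fun i hi => by rw [htake i hi]
    _ = ∑ _i ∈ nodeG g q, F q * AhatG r (nodeG g q) := by
      rw [← Finset.mul_sum, sum_advG_eq_card_mul_AhatG r hne, Finset.sum_const, nsmul_eq_mul]
      ring
    _ = _ := Finset.sum_congr rfl fun i hi => by rw [htake i hi]

/-- Exchange the sum over trajectories with the sum over token positions. -/
theorem sum_sum_range_length_comm {α : Type*} {k : ℕ} (g : Fin k → List α)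
    (f : Fin k → ℕ → ℝ) :
    ∑ i, ∑ t ∈ Finset.range (g i).length, f i t =
      ∑ t ∈ Finset.range (Finset.univ.sup fun i => (g i).length),
        ∑ i with t < (g i).length, f i t := by
  refine Finset.sum_comm' fun i t => ?_
  simp only [Finset.mem_univ, Finset.mem_range, true_and, Finset.mem_filter]
  exact ⟨fun h => ⟨h, h.trans_le
    (Finset.le_sup (f := fun i => (g i).length) (Finset.mem_univ i))⟩, fun h => h.1⟩

/-- **Theorem 1, generalized form.** For arbitrary prefix-dependent token weights
`P_{i,t} = F (gᵢ.take (t+1))` and `D_{i,t} = H (gᵢ.take (t+1))`, replacing outcome-level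
advantages by step-level advantages does not change the GRPO loss. -/
theorem grpo_loss_eq_prm_loss_general {α : Type*} {k : ℕ} (hk : 1 ≤ k)
    (g : Fin k → List α) (r : Fin k → ℝ) (hstd : 0 < rstdG r)
    (F H : List α → ℝ) :
    ∑ i, ∑ t ∈ Finset.range (g i).length,
        (F ((g i).take (t + 1)) * advG r i - H ((g i).take (t + 1))) =
      ∑ i, ∑ t ∈ Finset.range (g i).length,
        (F ((g i).take (t + 1)) * AhatG r (nodeG g ((g i).take (t + 1))) -
          H ((g i).take (t + 1))) := by
  simp only [Finset.sum_sub_distrib, sum_sum_range_length_comm g]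
  congr 1
  exact Finset.sum_congr rfl fun t _ => sum_mul_advG_eq_sum_mul_AhatG g r F t
end

section
/- (X_t is a partition.) For every integer t ≥ 0, the family X_t = {λ ∈ B(G) : s(λ) ≤ t < e(λ)} consists of pairwise disjoint sets, and the union of the sets in X_t equals {i ∈ {1,…,k} : t < len(g_i)}; i.e., X_t is a partition of the set of indices of trajectories of length greater than t. -/
theorem nodeG_mem_BG {α : Type*} {k : ℕ} {g : Fin k → List α} {p : List α} {i : Fin k}
    (h : p <+: g i) : nodeG g p ∈ BG g :=
  ⟨p, ⟨i, mem_nodeG.2 h⟩, rfl⟩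

theorem le_eG_iff {α : Type*} {k : ℕ} {g : Fin k → List α} {L : Finset (Fin k)} {i : Fin k}
    (hi : i ∈ L) {n : ℕ} :
    n ≤ eG g L ↔ n ≤ (g i).length ∧ L ⊆ nodeG g ((g i).take n) := by
  have hb : BddAbove {n : ℕ | ∃ p : List α, p.length = n ∧ ∀ i ∈ L, p <+: g i} := by
    refine ⟨(g i).length, ?_⟩
    rintro _ ⟨p, rfl, hp⟩
    exact (hp i hi).length_le
  constructor
  · intro h
    have hne : {n : ℕ | ∃ p : List α, p.length = n ∧ ∀ i ∈ L, p <+: g i}.Nonempty :=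
      ⟨0, [], rfl, fun _ _ => List.nil_prefix⟩
    obtain ⟨p, hp, hpre⟩ := Nat.sSup_mem hne hb
    have hn : n ≤ p.length := h.trans_eq hp.symm
    refine ⟨hn.trans (hpre i hi).length_le, fun j hj => mem_nodeG.2 ?_⟩
    have ht : (g i).take n = p.take n := by
      obtain ⟨q, hq⟩ := hpre i hi
      rw [← hq, List.take_append_of_le_length hn]
    rw [ht]
    exact (List.take_prefix n p).trans (hpre j hj)
  · rintro ⟨hn, hL⟩
    exact le_csSup hb ⟨(g i).take n, by simp [hn], fun j hj => mem_nodeG.1 (hL hj)⟩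

theorem BG_subset_or_subset {α : Type*} {k : ℕ} {g : Fin k → List α} {L M : Finset (Fin k)}
    (hL : L ∈ BG g) (hM : M ∈ BG g) {i : Fin k} (hiL : i ∈ L) (hiM : i ∈ M) :
    L ⊆ M ∨ M ⊆ L := by
  obtain ⟨p, -, rfl⟩ := hL
  obtain ⟨q, -, rfl⟩ := hM
  rcases List.prefix_or_prefix_of_prefix (mem_nodeG.1 hiL) (mem_nodeG.1 hiM) with h | h
  · exact Or.inr fun j hj => mem_nodeG.2 (h.trans (mem_nodeG.1 hj))
  · exact Or.inl fun j hj => mem_nodeG.2 (h.trans (mem_nodeG.1 hj))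

theorem parentG_spec {α : Type*} {k : ℕ} {g : Fin k → List α} {L : Finset (Fin k)} {i : Fin k}
    (hi : i ∈ L) (hne : L ≠ Finset.univ) :
    L ⊂ parentG g L ∧ ∀ M ∈ BG g, L ⊂ M → parentG g L ⊆ M := by
  have hex : ∃ M, M ∈ BG g ∧ L ⊂ M ∧ ∀ M' ∈ BG g, L ⊂ M' → M ⊆ M' := by
    have huniv : nodeG g [] = Finset.univ := by
      ext j
      simp [mem_nodeG]
    have hroot : Finset.univ ∈ BG g := huniv ▸ nodeG_mem_BG (i := i) List.nil_prefix
    obtain ⟨M, ⟨hM, hLM⟩, hmin⟩ := (Set.toFinite {M | M ∈ BG g ∧ L ⊂ M}).exists_minimal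
      ⟨_, hroot, Finset.ssubset_univ_iff.2 hne⟩
    refine ⟨M, hM, hLM, fun M' hM' hLM' => ?_⟩
    rcases BG_subset_or_subset hM hM' (hLM.subset hi) (hLM'.subset hi) with h | h
    · exact h
    · exact hmin ⟨hM', hLM'⟩ h
  rw [parentG, dif_pos hex]
  exact hex.choose_spec.2

/-- The only process set of `XtG g t` that can contain `i` is the node of the prefix of `g i`
of length `t + 1`. -/
theorem mem_XtG_iff {α : Type*} {k : ℕ} {g : Fin k → List α} {t : ℕ} {L : Finset (Fin k)}
    {i : Fin k} (hi : i ∈ L) :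
    L ∈ XtG g t ↔ t < (g i).length ∧ L = nodeG g ((g i).take (t + 1)) := by
  have hN : nodeG g ((g i).take (t + 1)) ∈ BG g := nodeG_mem_BG (List.take_prefix _ _)
  simp only [XtG, Finset.mem_filter, Finset.mem_univ, true_and]
  constructor
  · rintro ⟨-, hs, he⟩
    obtain ⟨hlen, hsub⟩ := (le_eG_iff hi).1 (Nat.succ_le_of_lt he)
    refine ⟨hlen, by_contra fun hne => ?_⟩
    have hlt := hsub.ssubset_of_ne hne
    have hroot : L ≠ Finset.univ := (hlt.trans_subset (Finset.subset_univ _)).ne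
    obtain ⟨hLP, hmin⟩ := parentG_spec (g := g) hi hroot
    have hP := (le_eG_iff (hLP.subset hi)).2 ⟨hlen, hmin _ hN hlt⟩
    rw [sG, if_neg hroot] at hs
    omega
  · rintro ⟨hlen, hL⟩
    refine ⟨hL ▸ hN, ?_, Nat.lt_of_succ_le ((le_eG_iff hi).2 ⟨hlen, hL.subset⟩)⟩
    rw [sG]
    split_ifs with hroot
    · exact Nat.zero_le t
    · obtain ⟨hLP, -⟩ := parentG_spec (g := g) hi hroot
      by_contra! hlt
      exact hLP.not_subset
        (((le_eG_iff (hLP.subset hi)).1 (Nat.succ_le_of_lt hlt)).2.trans hL.symm.subset)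

/-- **`X_t` is a partition.** For every `t ≥ 0`, the sets in
`X_t = {λ ∈ B(G) : s(λ) ≤ t < e(λ)}` are pairwise disjoint and their union is exactly the
set of indices of trajectories of length greater than `t`. -/
theorem Xt_is_partition {α : Type*} {k : ℕ} (hk : 1 ≤ k)
    (g : Fin k → List α) (t : ℕ) :
    ((XtG g t : Set (Finset (Fin k))).Pairwise fun L M => Disjoint L M) ∧
      (XtG g t).biUnion id =
        @Finset.filter _ (fun i => t < (g i).length) (Classical.decPred _) Finset.univ := by
  constructor
  · intro L hL M hM hne
    refine Finset.disjoint_left.2 fun i hiL hiM => hne ?_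
    exact ((mem_XtG_iff hiL).1 hL).2.trans ((mem_XtG_iff hiM).1 hM).2.symm
  · ext i
    simp only [Finset.mem_biUnion, id, Finset.mem_filter, Finset.mem_univ, true_and]
    constructor
    · rintro ⟨L, hL, hi⟩
      exact ((mem_XtG_iff hi).1 hL).1
    · intro hlen
      have hi : i ∈ nodeG g ((g i).take (t + 1)) := mem_nodeG.2 (List.take_prefix _ _)
      exact ⟨_, (mem_XtG_iff hi).2 ⟨hlen, rfl⟩, hi⟩
end

section
/- (Each process set is the node of its longest common prefix, and non-root process steps are nonempty.) Every λ ∈ B(G) satisfies λ = node(c_λ), where c_λ is the longest common prefix of the trajectories {g_i : i ∈ λ} (so len(c_λ) = e(λ)). Moreover, for every non-root λ ∈ B(G), e(parent(λ)) < e(λ); equivalently, s(λ) < e(λ), i.e., the process step spanned by λ contains at least one token. -/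
theorem nodeG_nil {α : Type*} {k : ℕ} (g : Fin k → List α) :
    nodeG g [] = Finset.univ := by
  ext i
  simp [mem_nodeG]

theorem univ_mem_BG {α : Type*} {k : ℕ} (hk : 1 ≤ k) (g : Fin k → List α) :
    Finset.univ ∈ BG g :=
  ⟨[], ⟨⟨0, hk⟩, mem_nodeG.2 List.nil_prefix⟩, nodeG_nil g⟩

theorem nonempty_of_mem_BG {α : Type*} {k : ℕ} {g : Fin k → List α} {L : Finset (Fin k)}
    (hL : L ∈ BG g) : L.Nonempty := by
  obtain ⟨p, hp, rfl⟩ := hL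
  exact hp

/-- The length of a common prefix is bounded by the length of any trajectory of the set. -/
theorem bddAbove_length_common_prefix {α : Type*} {k : ℕ} (g : Fin k → List α)
    {L : Finset (Fin k)} (hL : L.Nonempty) :
    BddAbove {n : ℕ | ∃ p : List α, p.length = n ∧ ∀ i ∈ L, p <+: g i} := by
  obtain ⟨i, hi⟩ := hL
  refine ⟨(g i).length, ?_⟩
  rintro n ⟨p, rfl, hp⟩
  exact (hp i hi).length_le

theorem exists_longest_common_prefix {α : Type*} {k : ℕ} {g : Fin k → List α}
    {L : Finset (Fin k)} (hL : L ∈ BG g) :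
    ∃ c : List α, c.length = eG g L ∧ (∀ i ∈ L, c <+: g i) ∧ nodeG g c = L := by
  have hne := nonempty_of_mem_BG hL
  have hbdd := bddAbove_length_common_prefix g hne
  obtain ⟨c, hc, hcp⟩ : eG g L ∈ {n : ℕ | ∃ p : List α, p.length = n ∧ ∀ i ∈ L, p <+: g i} :=
    Nat.sSup_mem ⟨0, [], rfl, fun _ _ => List.nil_prefix⟩ hbdd
  refine ⟨c, hc, hcp, Finset.Subset.antisymm ?_ fun i hi => mem_nodeG.2 (hcp i hi)⟩
  obtain ⟨p, -, rfl⟩ := hL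
  have hp : ∀ i ∈ nodeG g p, p <+: g i := fun i hi => mem_nodeG.1 hi
  have hlen : p.length ≤ c.length := hc ▸ le_csSup hbdd ⟨p, rfl, hp⟩
  obtain ⟨i, hi⟩ := hne
  have hpc : p <+: c := List.prefix_of_prefix_length_le (hp i hi) (hcp i hi) hlen
  exact fun j hj => mem_nodeG.2 (hpc.trans (mem_nodeG.1 hj))

theorem eG_lt_eG_of_ssubset {α : Type*} {k : ℕ} {g : Fin k → List α} {L M : Finset (Fin k)}
    (hL : L ∈ BG g) (hM : M ∈ BG g) (hLM : L ⊂ M) : eG g M < eG g L := by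
  obtain ⟨c, hc, hcp, hcL⟩ := exists_longest_common_prefix hL
  obtain ⟨d, hd, hdp, -⟩ := exists_longest_common_prefix hM
  by_contra! hle
  obtain ⟨i, hi⟩ := nonempty_of_mem_BG hL
  have hcd : c <+: d :=
    List.prefix_of_prefix_length_le (hcp i hi) (hdp i (hLM.subset hi)) (by omega)
  exact hLM.not_subset fun j hj => hcL ▸ mem_nodeG.2 (hcd.trans (hdp j hj))

theorem parentG_mem_BG_and_ssubset {α : Type*} {k : ℕ} (hk : 1 ≤ k) (g : Fin k → List α)
    {L : Finset (Fin k)} (hL : L ≠ Finset.univ) : parentG g L ∈ BG g ∧ L ⊂ parentG g L := by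
  unfold parentG
  split_ifs with h
  · exact ⟨h.choose_spec.1, h.choose_spec.2.1⟩
  · exact ⟨univ_mem_BG hk g, Finset.ssubset_univ_iff.2 hL⟩

/-- **Each process set is the node of its longest common prefix, and non-root process steps
are nonempty.** Every `λ ∈ B(G)` satisfies `λ = node c` where `c` is the longest common
prefix of `{gᵢ : i ∈ λ}` (so `len c = e(λ)`); moreover, for non-root `λ`,
`e(parent λ) < e(λ)`, equivalently `s(λ) < e(λ)`. -/
theorem process_set_eq_node_of_lcp {α : Type*} {k : ℕ} (hk : 1 ≤ k)
    (g : Fin k → List α) (L : Finset (Fin k)) (hL : L ∈ BG g) :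
    (∃ c : List α, c.length = eG g L ∧ (∀ i ∈ L, c <+: g i) ∧ nodeG g c = L) ∧
      (L ≠ Finset.univ → eG g (parentG g L) < eG g L ∧ sG g L < eG g L) := by
  refine ⟨exists_longest_common_prefix hL, fun hne => ?_⟩
  obtain ⟨hP, hLP⟩ := parentG_mem_BG_and_ssubset hk g hne
  have hlt := eG_lt_eG_of_ssubset hL hP hLP
  exact ⟨hlt, by rwa [sG, if_neg hne]⟩
end
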